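/- In the λ̄μμ̃-calculus with explicit substitutions, for every syntactic object t (command, term, or context), Ateb(t) reduces to t in zero or more reduction steps, and Ateb(t) contains no explicit substitutions. -/

import Mathlib

namespace LambdaBarMuMuTilde

/-- Types: base types, arrow `A → B` and difference `A − B`. -/
inductive Ty : Type
  | base : Ty
  | arrow : Ty → Ty → Ty
  | diff : Ty → Ty → Ty

mutual
/-- Commands `c ::= ⟨v|e⟩ | cτ`. -/
inductive Cmd : Type
  | cut : Tv → Te → Cmd
  | csub : Cmd → Su → Cmd

/-- Terms `v ::= x | λx.v | e·v | μα.c | vτ`. -/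
inductive Tv : Type
  | tvar : ℕ → Tv
  | lam : ℕ → Tv → Tv
  | edot : Te → Tv → Tv
  | mu : ℕ → Cmd → Tv
  | vsub : Tv → Su → Tv

/-- Contexts `e ::= α | αλ.e | v·e | μ̃x.c | eτ`. -/
inductive Te : Type
  | cvar : ℕ → Te
  | colam : ℕ → Te → Te
  | vdot : Tv → Te → Te
  | mut : ℕ → Cmd → Te
  | esub : Te → Su → Te

/-- Explicit substitutions `τ ::= [x←v] | [α←e]`. -/
inductive Su : Type
  | ts : ℕ → Tv → Su
  | cs : ℕ → Te → Su
end

/-- Typing environments. -/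
abbrev Env := ℕ → Option Ty

mutual
/-- Typing of commands: `TypC Γ c Δ` is `c : (Γ ⊢ Δ)`. -/
inductive TypC : Env → Cmd → Env → Prop
  | cut {Γ Δ : Env} {v : Tv} {e : Te} {A : Ty} :
      TypV Γ v A Δ → TypE Γ e A Δ → TypC Γ (.cut v e) Δ
  | csub {Γ Δ Γ' Δ' : Env} {c : Cmd} {τ : Su} :
      TypC Γ c Δ → TypS τ Γ Δ Γ' Δ' → TypC Γ' (.csub c τ) Δ'

/-- Typing of terms: `TypV Γ v A Δ` is `Γ ⊢ v : A | Δ`. -/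
inductive TypV : Env → Tv → Ty → Env → Prop
  | tvar {Γ Δ : Env} {x : ℕ} {A : Ty} : Γ x = some A → TypV Γ (.tvar x) A Δ
  | lam {Γ Δ : Env} {x : ℕ} {v : Tv} {A B : Ty} :
      TypV (Function.update Γ x (some A)) v B Δ →
      TypV Γ (.lam x v) (.arrow A B) Δ
  | edot {Γ Δ : Env} {v : Tv} {e : Te} {A B : Ty} :
      TypV Γ v B Δ → TypE Γ e A Δ → TypV Γ (.edot e v) (.diff A B) Δ
  | mu {Γ Δ : Env} {a : ℕ} {c : Cmd} {A : Ty} :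
      TypC Γ c (Function.update Δ a (some A)) → TypV Γ (.mu a c) A Δ
  | vsub {Γ Δ Γ' Δ' : Env} {v : Tv} {τ : Su} {A : Ty} :
      TypV Γ v A Δ → TypS τ Γ Δ Γ' Δ' → TypV Γ' (.vsub v τ) A Δ'

/-- Typing of contexts: `TypE Γ e A Δ` is `Γ | e : A ⊢ Δ`. -/
inductive TypE : Env → Te → Ty → Env → Prop
  | cvar {Γ Δ : Env} {a : ℕ} {A : Ty} : Δ a = some A → TypE Γ (.cvar a) A Δ
  | colam {Γ Δ : Env} {a : ℕ} {e : Te} {A B : Ty} :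
      TypE Γ e B (Function.update Δ a (some A)) →
      TypE Γ (.colam a e) (.diff A B) Δ
  | vdot {Γ Δ : Env} {v : Tv} {e : Te} {A B : Ty} :
      TypV Γ v A Δ → TypE Γ e B Δ → TypE Γ (.vdot v e) (.arrow A B) Δ
  | mut {Γ Δ : Env} {x : ℕ} {c : Cmd} {A : Ty} :
      TypC (Function.update Γ x (some A)) c Δ → TypE Γ (.mut x c) A Δ
  | esub {Γ Δ Γ' Δ' : Env} {e : Te} {τ : Su} {A : Ty} :
      TypE Γ e A Δ → TypS τ Γ Δ Γ' Δ' → TypE Γ' (.esub e τ) A Δ'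

/-- Typing of substitutions: `TypS τ Γ Δ Γ' Δ'` is
`τ : (Γ ⊢ Δ) ⇒ (Γ' ⊢ Δ')`. -/
inductive TypS : Su → Env → Env → Env → Env → Prop
  | ts {Γ Δ : Env} {x : ℕ} {v : Tv} {A : Ty} :
      TypV Γ v A Δ → TypS (.ts x v) (Function.update Γ x (some A)) Δ Γ Δ
  | cs {Γ Δ : Env} {a : ℕ} {e : Te} {A : Ty} :
      TypE Γ e A Δ → TypS (.cs a e) Γ (Function.update Δ a (some A)) Γ Δ
end

-- Maximum of all variable indices (term variables and context variables,
-- free or bound) occurring in a syntactic object; used to pick fresh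
-- variables.
mutual
def mvC : Cmd → ℕ
  | .cut v e => max (mvV v) (mvE e)
  | .csub c τ => max (mvC c) (mvS τ)
def mvV : Tv → ℕ
  | .tvar x => x
  | .lam x v => max x (mvV v)
  | .edot e v => max (mvE e) (mvV v)
  | .mu a c => max a (mvC c)
  | .vsub v τ => max (mvV v) (mvS τ)
def mvE : Te → ℕ
  | .cvar a => a
  | .colam a e => max a (mvE e)
  | .vdot v e => max (mvV v) (mvE e)
  | .mut x c => max x (mvC c)
  | .esub e τ => max (mvE e) (mvS τ)
def mvS : Su → ℕ
  | .ts x v => max x (mvV v)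
  | .cs a e => max a (mvE e)
end

mutual
/-- The expansion `Ateb` on commands. -/
def AtebC : Cmd → Cmd
  | .cut v e => .cut (AtebV v) (AtebE e)
  | .csub c (.ts x v) => .cut (AtebV v) (.mut x (AtebC c))
  | .csub c (.cs a e) => .cut (.mu a (AtebC c)) (AtebE e)

/-- The expansion `Ateb` on terms (the variables `α`, `β` below are chosen
fresh). -/
def AtebV : Tv → Tv
  | .tvar x => .tvar x
  | .lam x v => .lam x (AtebV v)
  | .edot e v => .edot (AtebE e) (AtebV v)
  | .mu a c => .mu a (AtebC c)
  | .vsub v (.ts x v') =>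
      let w := AtebV v
      let w' := AtebV v'
      let a := max (max (mvV w) (mvV w')) x + 1
      .mu a (.cut (.lam x w) (.vdot w' (.cvar a)))
  | .vsub v (.cs a e) =>
      let w := AtebV v
      let f := AtebE e
      let b := max (max (mvV w) (mvE f)) a + 1
      .mu b (.cut (.mu a (.cut w (.cvar b))) f)

/-- The expansion `Ateb` on contexts (the variables `y`, `x` below are
chosen fresh). -/
def AtebE : Te → Te
  | .cvar a => .cvar a
  | .colam a e => .colam a (AtebE e)
  | .vdot v e => .vdot (AtebV v) (AtebE e)
  | .mut x c => .mut x (AtebC c)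
  | .esub e (.ts x v) =>
      let f := AtebE e
      let w := AtebV v
      let y := max (max (mvE f) (mvV w)) x + 1
      .mut y (.cut w (.mut x (.cut (.tvar y) f)))
  | .esub e (.cs a e') =>
      let f := AtebE e
      let f' := AtebE e'
      let x := max (max (mvE f) (mvE f')) a + 1
      .mut x (.cut (.edot f' (.tvar x)) (.colam a f))
end

mutual
/-- Commands containing no explicit substitution. -/
inductive NoSubC : Cmd → Prop
  | cut {v : Tv} {e : Te} : NoSubV v → NoSubE e → NoSubC (.cut v e)

/-- Terms containing no explicit substitution. -/
inductive NoSubV : Tv → Prop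
  | tvar (x : ℕ) : NoSubV (.tvar x)
  | lam {v : Tv} (x : ℕ) : NoSubV v → NoSubV (.lam x v)
  | edot {e : Te} {v : Tv} : NoSubE e → NoSubV v → NoSubV (.edot e v)
  | mu {c : Cmd} (a : ℕ) : NoSubC c → NoSubV (.mu a c)

/-- Contexts containing no explicit substitution. -/
inductive NoSubE : Te → Prop
  | cvar (a : ℕ) : NoSubE (.cvar a)
  | colam {e : Te} (a : ℕ) : NoSubE e → NoSubE (.colam a e)
  | vdot {v : Tv} {e : Te} : NoSubV v → NoSubE e → NoSubE (.vdot v e)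
  | mut {c : Cmd} (x : ℕ) : NoSubC c → NoSubE (.mut x c)
end

-- Free term variables.
mutual
def ftvC : Cmd → Finset ℕ
  | .cut v e => ftvV v ∪ ftvE e
  | .csub c (.ts x v) => (ftvC c \ {x}) ∪ ftvV v
  | .csub c (.cs _ e) => ftvC c ∪ ftvE e
def ftvV : Tv → Finset ℕ
  | .tvar x => {x}
  | .lam x v => ftvV v \ {x}
  | .edot e v => ftvE e ∪ ftvV v
  | .mu _ c => ftvC c
  | .vsub v (.ts x w) => (ftvV v \ {x}) ∪ ftvV w
  | .vsub v (.cs _ e) => ftvV v ∪ ftvE e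
def ftvE : Te → Finset ℕ
  | .cvar _ => ∅
  | .colam _ e => ftvE e
  | .vdot v e => ftvV v ∪ ftvE e
  | .mut x c => ftvC c \ {x}
  | .esub e (.ts x w) => (ftvE e \ {x}) ∪ ftvV w
  | .esub e (.cs _ e') => ftvE e ∪ ftvE e'
end

-- Free context variables.
mutual
def fcvC : Cmd → Finset ℕ
  | .cut v e => fcvV v ∪ fcvE e
  | .csub c (.ts _ v) => fcvC c ∪ fcvV v
  | .csub c (.cs a e) => (fcvC c \ {a}) ∪ fcvE e
def fcvV : Tv → Finset ℕ
  | .tvar _ => ∅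
  | .lam _ v => fcvV v
  | .edot e v => fcvE e ∪ fcvV v
  | .mu a c => fcvC c \ {a}
  | .vsub v (.ts _ w) => fcvV v ∪ fcvV w
  | .vsub v (.cs a e) => (fcvV v \ {a}) ∪ fcvE e
def fcvE : Te → Finset ℕ
  | .cvar a => {a}
  | .colam a e => fcvE e \ {a}
  | .vdot v e => fcvV v ∪ fcvE e
  | .mut _ c => fcvC c
  | .esub e (.ts _ w) => fcvE e ∪ fcvV w
  | .esub e (.cs a e') => (fcvE e \ {a}) ∪ fcvE e'
end

mutual
/-- Reduction of commands, closed under arbitrary contexts. -/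
inductive RedC : Cmd → Cmd → Prop
  -- (β)
  | beta {x : ℕ} {v v' : Tv} {e : Te} :
      RedC (.cut (.lam x v) (.vdot v' e)) (.cut v' (.mut x (.cut v e)))
  -- (β̃)
  | tbeta {a : ℕ} {v : Tv} {e e' : Te} :
      RedC (.cut (.edot e' v) (.colam a e)) (.cut (.mu a (.cut v e)) e')
  -- (μ)
  | mu {a : ℕ} {c : Cmd} {e : Te} :
      RedC (.cut (.mu a c) e) (.csub c (.cs a e))
  -- (μ̃)
  | mut {x : ℕ} {c : Cmd} {v : Tv} :
      RedC (.cut v (.mut x c)) (.csub c (.ts x v))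
  -- (cτ)
  | ctau {v : Tv} {e : Te} {τ : Su} :
      RedC (.csub (.cut v e) τ) (.cut (.vsub v τ) (.esub e τ))
  -- congruences
  | cutl {v v' : Tv} {e : Te} : RedV v v' → RedC (.cut v e) (.cut v' e)
  | cutr {v : Tv} {e e' : Te} : RedE e e' → RedC (.cut v e) (.cut v e')
  | csubc {c c' : Cmd} {τ : Su} : RedC c c' → RedC (.csub c τ) (.csub c' τ)
  | csubs {c : Cmd} {τ τ' : Su} : RedS τ τ' → RedC (.csub c τ) (.csub c τ')

/-- Reduction of terms, closed under arbitrary contexts. -/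
inductive RedV : Tv → Tv → Prop
  -- (xτ1)
  | xtau1 {x : ℕ} {v : Tv} : RedV (.vsub (.tvar x) (.ts x v)) v
  -- (xτ2)
  | xtau2_ts {x y : ℕ} {v : Tv} : x ≠ y →
      RedV (.vsub (.tvar x) (.ts y v)) (.tvar x)
  | xtau2_cs {x a : ℕ} {e : Te} : RedV (.vsub (.tvar x) (.cs a e)) (.tvar x)
  -- (·̃τ)
  | tdottau {e : Te} {v : Tv} {τ : Su} :
      RedV (.vsub (.edot e v) τ) (.edot (.esub e τ) (.vsub v τ))
  -- (λτ), with α-conversion where necessary: the bound variable is taken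
  -- away from the substitution
  | lamtau_ts {x y : ℕ} {v w : Tv} : x ≠ y → x ∉ ftvV w →
      RedV (.vsub (.lam x v) (.ts y w)) (.lam x (.vsub v (.ts y w)))
  | lamtau_cs {x a : ℕ} {v : Tv} {e : Te} : x ∉ ftvE e →
      RedV (.vsub (.lam x v) (.cs a e)) (.lam x (.vsub v (.cs a e)))
  -- (μτ)
  | mutau_ts {a x : ℕ} {c : Cmd} {w : Tv} : a ∉ fcvV w →
      RedV (.vsub (.mu a c) (.ts x w)) (.mu a (.csub c (.ts x w)))
  | mutau_cs {a b : ℕ} {c : Cmd} {e : Te} : a ≠ b → a ∉ fcvE e →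
      RedV (.vsub (.mu a c) (.cs b e)) (.mu a (.csub c (.cs b e)))
  -- (sv)
  | sv {a : ℕ} {v : Tv} : a ∉ fcvV v → RedV (.mu a (.cut v (.cvar a))) v
  -- congruences
  | lam {x : ℕ} {v v' : Tv} : RedV v v' → RedV (.lam x v) (.lam x v')
  | edotl {e e' : Te} {v : Tv} : RedE e e' → RedV (.edot e v) (.edot e' v)
  | edotr {e : Te} {v v' : Tv} : RedV v v' → RedV (.edot e v) (.edot e v')
  | mu {a : ℕ} {c c' : Cmd} : RedC c c' → RedV (.mu a c) (.mu a c')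
  | vsubv {v v' : Tv} {τ : Su} : RedV v v' → RedV (.vsub v τ) (.vsub v' τ)
  | vsubs {v : Tv} {τ τ' : Su} : RedS τ τ' → RedV (.vsub v τ) (.vsub v τ')

/-- Reduction of contexts, closed under arbitrary contexts. -/
inductive RedE : Te → Te → Prop
  -- (ατ1)
  | atau1 {a : ℕ} {e : Te} : RedE (.esub (.cvar a) (.cs a e)) e
  -- (ατ2)
  | atau2_cs {a b : ℕ} {e : Te} : a ≠ b →
      RedE (.esub (.cvar a) (.cs b e)) (.cvar a)
  | atau2_ts {a x : ℕ} {v : Tv} : RedE (.esub (.cvar a) (.ts x v)) (.cvar a)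
  -- (·τ)
  | vdottau {v : Tv} {e : Te} {τ : Su} :
      RedE (.esub (.vdot v e) τ) (.vdot (.vsub v τ) (.esub e τ))
  -- (λ̃τ)
  | colamtau_ts {a x : ℕ} {e : Te} {w : Tv} : a ∉ fcvV w →
      RedE (.esub (.colam a e) (.ts x w)) (.colam a (.esub e (.ts x w)))
  | colamtau_cs {a b : ℕ} {e e' : Te} : a ≠ b → a ∉ fcvE e' →
      RedE (.esub (.colam a e) (.cs b e')) (.colam a (.esub e (.cs b e')))
  -- (μ̃τ)
  | muttau_ts {x y : ℕ} {c : Cmd} {w : Tv} : x ≠ y → x ∉ ftvV w →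
      RedE (.esub (.mut x c) (.ts y w)) (.mut x (.csub c (.ts y w)))
  | muttau_cs {x a : ℕ} {c : Cmd} {e : Te} : x ∉ ftvE e →
      RedE (.esub (.mut x c) (.cs a e)) (.mut x (.csub c (.cs a e)))
  -- (se)
  | se {x : ℕ} {e : Te} : x ∉ ftvE e → RedE (.mut x (.cut (.tvar x) e)) e
  -- congruences
  | colam {a : ℕ} {e e' : Te} : RedE e e' → RedE (.colam a e) (.colam a e')
  | vdotl {v v' : Tv} {e : Te} : RedV v v' → RedE (.vdot v e) (.vdot v' e)
  | vdotr {v : Tv} {e e' : Te} : RedE e e' → RedE (.vdot v e) (.vdot v e')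
  | mut {x : ℕ} {c c' : Cmd} : RedC c c' → RedE (.mut x c) (.mut x c')
  | esube {e e' : Te} {τ : Su} : RedE e e' → RedE (.esub e τ) (.esub e' τ)
  | esubs {e : Te} {τ τ' : Su} : RedS τ τ' → RedE (.esub e τ) (.esub e τ')

/-- Reduction inside explicit substitutions. -/
inductive RedS : Su → Su → Prop
  | ts {x : ℕ} {v v' : Tv} : RedV v v' → RedS (.ts x v) (.ts x v')
  | cs {a : ℕ} {e e' : Te} : RedE e e' → RedS (.cs a e) (.cs a e')
end


/-! Free variables are bounded by the maximal variable index. -/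

mutual
theorem le_mvC_of_mem_ftvC {n : ℕ} : ∀ c : Cmd, n ∈ ftvC c → n ≤ mvC c
  | .cut v e => by
      have := le_mvV_of_mem_ftvV (n := n) v
      have := le_mvE_of_mem_ftvE (n := n) e
      grind [ftvC, mvC]
  | .csub c (.ts x v) => by
      have := le_mvC_of_mem_ftvC (n := n) c
      have := le_mvV_of_mem_ftvV (n := n) v
      grind [ftvC, mvC, mvS]
  | .csub c (.cs a e) => by
      have := le_mvC_of_mem_ftvC (n := n) c
      have := le_mvE_of_mem_ftvE (n := n) e
      grind [ftvC, mvC, mvS]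

theorem le_mvV_of_mem_ftvV {n : ℕ} : ∀ v : Tv, n ∈ ftvV v → n ≤ mvV v
  | .tvar x => by grind [ftvV, mvV]
  | .lam x v => by
      have := le_mvV_of_mem_ftvV (n := n) v
      grind [ftvV, mvV]
  | .edot e v => by
      have := le_mvE_of_mem_ftvE (n := n) e
      have := le_mvV_of_mem_ftvV (n := n) v
      grind [ftvV, mvV]
  | .mu a c => by
      have := le_mvC_of_mem_ftvC (n := n) c
      grind [ftvV, mvV]
  | .vsub v (.ts x w) => by
      have := le_mvV_of_mem_ftvV (n := n) v
      have := le_mvV_of_mem_ftvV (n := n) w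
      grind [ftvV, mvV, mvS]
  | .vsub v (.cs a e) => by
      have := le_mvV_of_mem_ftvV (n := n) v
      have := le_mvE_of_mem_ftvE (n := n) e
      grind [ftvV, mvV, mvS]

theorem le_mvE_of_mem_ftvE {n : ℕ} : ∀ e : Te, n ∈ ftvE e → n ≤ mvE e
  | .cvar a => by grind [ftvE, mvE]
  | .colam a e => by
      have := le_mvE_of_mem_ftvE (n := n) e
      grind [ftvE, mvE]
  | .vdot v e => by
      have := le_mvV_of_mem_ftvV (n := n) v
      have := le_mvE_of_mem_ftvE (n := n) e
      grind [ftvE, mvE]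
  | .mut x c => by
      have := le_mvC_of_mem_ftvC (n := n) c
      grind [ftvE, mvE]
  | .esub e (.ts x w) => by
      have := le_mvE_of_mem_ftvE (n := n) e
      have := le_mvV_of_mem_ftvV (n := n) w
      grind [ftvE, mvE, mvS]
  | .esub e (.cs a f) => by
      have := le_mvE_of_mem_ftvE (n := n) e
      have := le_mvE_of_mem_ftvE (n := n) f
      grind [ftvE, mvE, mvS]
end

mutual
theorem le_mvC_of_mem_fcvC {n : ℕ} : ∀ c : Cmd, n ∈ fcvC c → n ≤ mvC c
  | .cut v e => by
      have := le_mvV_of_mem_fcvV (n := n) v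
      have := le_mvE_of_mem_fcvE (n := n) e
      grind [fcvC, mvC]
  | .csub c (.ts x v) => by
      have := le_mvC_of_mem_fcvC (n := n) c
      have := le_mvV_of_mem_fcvV (n := n) v
      grind [fcvC, mvC, mvS]
  | .csub c (.cs a e) => by
      have := le_mvC_of_mem_fcvC (n := n) c
      have := le_mvE_of_mem_fcvE (n := n) e
      grind [fcvC, mvC, mvS]

theorem le_mvV_of_mem_fcvV {n : ℕ} : ∀ v : Tv, n ∈ fcvV v → n ≤ mvV v
  | .tvar x => by grind [fcvV, mvV]
  | .lam x v => by
      have := le_mvV_of_mem_fcvV (n := n) v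
      grind [fcvV, mvV]
  | .edot e v => by
      have := le_mvE_of_mem_fcvE (n := n) e
      have := le_mvV_of_mem_fcvV (n := n) v
      grind [fcvV, mvV]
  | .mu a c => by
      have := le_mvC_of_mem_fcvC (n := n) c
      grind [fcvV, mvV]
  | .vsub v (.ts x w) => by
      have := le_mvV_of_mem_fcvV (n := n) v
      have := le_mvV_of_mem_fcvV (n := n) w
      grind [fcvV, mvV, mvS]
  | .vsub v (.cs a e) => by
      have := le_mvV_of_mem_fcvV (n := n) v
      have := le_mvE_of_mem_fcvE (n := n) e
      grind [fcvV, mvV, mvS]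

theorem le_mvE_of_mem_fcvE {n : ℕ} : ∀ e : Te, n ∈ fcvE e → n ≤ mvE e
  | .cvar a => by grind [fcvE, mvE]
  | .colam a e => by
      have := le_mvE_of_mem_fcvE (n := n) e
      grind [fcvE, mvE]
  | .vdot v e => by
      have := le_mvV_of_mem_fcvV (n := n) v
      have := le_mvE_of_mem_fcvE (n := n) e
      grind [fcvE, mvE]
  | .mut x c => by
      have := le_mvC_of_mem_fcvC (n := n) c
      grind [fcvE, mvE]
  | .esub e (.ts x w) => by
      have := le_mvE_of_mem_fcvE (n := n) e
      have := le_mvV_of_mem_fcvV (n := n) w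
      grind [fcvE, mvE, mvS]
  | .esub e (.cs a f) => by
      have := le_mvE_of_mem_fcvE (n := n) e
      have := le_mvE_of_mem_fcvE (n := n) f
      grind [fcvE, mvE, mvS]
end

/-! Each clause of `Ateb` on a substitution reduces back to that substitution. -/

theorem reduces_vsub_ts {a x : ℕ} {v w : Tv} (hv : a ∉ fcvV v) (hw : a ∉ fcvV w) :
    Relation.ReflTransGen RedV (.mu a (.cut (.lam x v) (.vdot w (.cvar a)))) (.vsub v (.ts x w)) :=
  .head (.mu .beta) <| .head (.mu .mut) <| .head (.mu .ctau) <|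
    .head (.mu (.cutr .atau2_ts)) <| .single <| .sv (by simp [fcvV, hv, hw])

theorem reduces_vsub_cs {a b : ℕ} {v : Tv} {e : Te} (hba : b ≠ a) (hv : b ∉ fcvV v)
    (he : b ∉ fcvE e) :
    Relation.ReflTransGen RedV (.mu b (.cut (.mu a (.cut v (.cvar b))) e)) (.vsub v (.cs a e)) :=
  .head (.mu .mu) <| .head (.mu .ctau) <| .head (.mu (.cutr (.atau2_cs hba))) <|
    .single <| .sv (by simp [fcvV, hv, he])

theorem reduces_esub_ts {x y : ℕ} {e : Te} {v : Tv} (hyx : y ≠ x) (he : y ∉ ftvE e)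
    (hv : y ∉ ftvV v) :
    Relation.ReflTransGen RedE (.mut y (.cut v (.mut x (.cut (.tvar y) e)))) (.esub e (.ts x v)) :=
  .head (.mut .mut) <| .head (.mut .ctau) <| .head (.mut (.cutl (.xtau2_ts hyx))) <|
    .single <| .se (by simp [ftvE, he, hv])

theorem reduces_esub_cs {a x : ℕ} {e f : Te} (he : x ∉ ftvE e) (hf : x ∉ ftvE f) :
    Relation.ReflTransGen RedE (.mut x (.cut (.edot f (.tvar x)) (.colam a e))) (.esub e (.cs a f)) :=
  .head (.mut .tbeta) <| .head (.mut .mu) <| .head (.mut .ctau) <|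
    .head (.mut (.cutl .xtau2_cs)) <| .single <| .se (by simp [ftvE, he, hf])

/-! Congruence of many-step reduction for the binary constructors. -/

theorem reduces_cut {v v' : Tv} {e e' : Te} (hv : Relation.ReflTransGen RedV v v')
    (he : Relation.ReflTransGen RedE e e') : Relation.ReflTransGen RedC (.cut v e) (.cut v' e') :=
  (hv.lift (Cmd.cut · e) fun _ _ => .cutl).trans (he.lift _ fun _ _ => .cutr)

theorem reduces_edot {e e' : Te} {v v' : Tv} (he : Relation.ReflTransGen RedE e e')
    (hv : Relation.ReflTransGen RedV v v') : Relation.ReflTransGen RedV (.edot e v) (.edot e' v') :=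
  (he.lift (Tv.edot · v) fun _ _ => .edotl).trans (hv.lift _ fun _ _ => .edotr)

theorem reduces_vdot {v v' : Tv} {e e' : Te} (hv : Relation.ReflTransGen RedV v v')
    (he : Relation.ReflTransGen RedE e e') : Relation.ReflTransGen RedE (.vdot v e) (.vdot v' e') :=
  (hv.lift (Te.vdot · e) fun _ _ => .vdotl).trans (he.lift _ fun _ _ => .vdotr)

theorem reduces_csub {c c' : Cmd} {τ τ' : Su} (hc : Relation.ReflTransGen RedC c c')
    (hτ : Relation.ReflTransGen RedS τ τ') : Relation.ReflTransGen RedC (.csub c τ) (.csub c' τ') :=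
  (hc.lift (Cmd.csub · τ) fun _ _ => .csubc).trans (hτ.lift _ fun _ _ => .csubs)

theorem reduces_vsub {v v' : Tv} {τ τ' : Su} (hv : Relation.ReflTransGen RedV v v')
    (hτ : Relation.ReflTransGen RedS τ τ') : Relation.ReflTransGen RedV (.vsub v τ) (.vsub v' τ') :=
  (hv.lift (Tv.vsub · τ) fun _ _ => .vsubv).trans (hτ.lift _ fun _ _ => .vsubs)

theorem reduces_esub {e e' : Te} {τ τ' : Su} (he : Relation.ReflTransGen RedE e e')
    (hτ : Relation.ReflTransGen RedS τ τ') : Relation.ReflTransGen RedE (.esub e τ) (.esub e' τ') :=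
  (he.lift (Te.esub · τ) fun _ _ => .esube).trans (hτ.lift _ fun _ _ => .esubs)

theorem reduces_ts {x : ℕ} {v v' : Tv} (hv : Relation.ReflTransGen RedV v v') :
    Relation.ReflTransGen RedS (.ts x v) (.ts x v') :=
  hv.lift _ fun _ _ => .ts

theorem reduces_cs {a : ℕ} {e e' : Te} (he : Relation.ReflTransGen RedE e e') :
    Relation.ReflTransGen RedS (.cs a e) (.cs a e') :=
  he.lift _ fun _ _ => .cs

mutual
theorem AtebC_reduces : ∀ c : Cmd, Relation.ReflTransGen RedC (AtebC c) c
  | .cut v e => by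
      rw [AtebC]
      exact reduces_cut (AtebV_reduces v) (AtebE_reduces e)
  | .csub c (.ts x v) => by
      rw [AtebC]
      exact .head .mut (reduces_csub (AtebC_reduces c) (reduces_ts (AtebV_reduces v)))
  | .csub c (.cs a e) => by
      rw [AtebC]
      exact .head .mu (reduces_csub (AtebC_reduces c) (reduces_cs (AtebE_reduces e)))

theorem AtebV_reduces : ∀ v : Tv, Relation.ReflTransGen RedV (AtebV v) v
  | .tvar x => by
      rw [AtebV]
  | .lam x v => by
      rw [AtebV]
      exact (AtebV_reduces v).lift _ fun _ _ => .lam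
  | .edot e v => by
      rw [AtebV]
      exact reduces_edot (AtebE_reduces e) (AtebV_reduces v)
  | .mu a c => by
      rw [AtebV]
      exact (AtebC_reduces c).lift _ fun _ _ => .mu
  | .vsub v (.ts x w) => by
      rw [AtebV]
      refine (reduces_vsub_ts ?_ ?_).trans
        (reduces_vsub (AtebV_reduces v) (reduces_ts (AtebV_reduces w)))
      · exact fun h => by have := le_mvV_of_mem_fcvV _ h; omega
      · exact fun h => by have := le_mvV_of_mem_fcvV _ h; omega
  | .vsub v (.cs a e) => by
      rw [AtebV]
      refine (reduces_vsub_cs ?_ ?_ ?_).trans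
        (reduces_vsub (AtebV_reduces v) (reduces_cs (AtebE_reduces e)))
      · omega
      · exact fun h => by have := le_mvV_of_mem_fcvV _ h; omega
      · exact fun h => by have := le_mvE_of_mem_fcvE _ h; omega

theorem AtebE_reduces : ∀ e : Te, Relation.ReflTransGen RedE (AtebE e) e
  | .cvar a => by
      rw [AtebE]
  | .colam a e => by
      rw [AtebE]
      exact (AtebE_reduces e).lift _ fun _ _ => .colam
  | .vdot v e => by
      rw [AtebE]
      exact reduces_vdot (AtebV_reduces v) (AtebE_reduces e)
  | .mut x c => by
      rw [AtebE]
      exact (AtebC_reduces c).lift _ fun _ _ => .mut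
  | .esub e (.ts x v) => by
      rw [AtebE]
      refine (reduces_esub_ts ?_ ?_ ?_).trans
        (reduces_esub (AtebE_reduces e) (reduces_ts (AtebV_reduces v)))
      · omega
      · exact fun h => by have := le_mvE_of_mem_ftvE _ h; omega
      · exact fun h => by have := le_mvV_of_mem_ftvV _ h; omega
  | .esub e (.cs a f) => by
      rw [AtebE]
      refine (reduces_esub_cs ?_ ?_).trans
        (reduces_esub (AtebE_reduces e) (reduces_cs (AtebE_reduces f)))
      · exact fun h => by have := le_mvE_of_mem_ftvE _ h; omega
      · exact fun h => by have := le_mvE_of_mem_ftvE _ h; omega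
end

mutual
theorem noSubC_AtebC : ∀ c : Cmd, NoSubC (AtebC c)
  | .cut v e => by
      rw [AtebC]
      exact .cut (noSubV_AtebV v) (noSubE_AtebE e)
  | .csub c (.ts x v) => by
      rw [AtebC]
      exact .cut (noSubV_AtebV v) (.mut _ (noSubC_AtebC c))
  | .csub c (.cs a e) => by
      rw [AtebC]
      exact .cut (.mu _ (noSubC_AtebC c)) (noSubE_AtebE e)

theorem noSubV_AtebV : ∀ v : Tv, NoSubV (AtebV v)
  | .tvar x => by
      rw [AtebV]
      exact .tvar x
  | .lam x v => by
      rw [AtebV]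
      exact .lam _ (noSubV_AtebV v)
  | .edot e v => by
      rw [AtebV]
      exact .edot (noSubE_AtebE e) (noSubV_AtebV v)
  | .mu a c => by
      rw [AtebV]
      exact .mu _ (noSubC_AtebC c)
  | .vsub v (.ts x w) => by
      rw [AtebV]
      exact .mu _ (.cut (.lam _ (noSubV_AtebV v)) (.vdot (noSubV_AtebV w) (.cvar _)))
  | .vsub v (.cs a e) => by
      rw [AtebV]
      exact .mu _ (.cut (.mu _ (.cut (noSubV_AtebV v) (.cvar _))) (noSubE_AtebE e))

theorem noSubE_AtebE : ∀ e : Te, NoSubE (AtebE e)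
  | .cvar a => by
      rw [AtebE]
      exact .cvar a
  | .colam a e => by
      rw [AtebE]
      exact .colam _ (noSubE_AtebE e)
  | .vdot v e => by
      rw [AtebE]
      exact .vdot (noSubV_AtebV v) (noSubE_AtebE e)
  | .mut x c => by
      rw [AtebE]
      exact .mut _ (noSubC_AtebC c)
  | .esub e (.ts x v) => by
      rw [AtebE]
      exact .mut _ (.cut (noSubV_AtebV v) (.mut _ (.cut (.tvar _) (noSubE_AtebE e))))
  | .esub e (.cs a f) => by
      rw [AtebE]
      exact .mut _ (.cut (.edot (noSubE_AtebE f) (.tvar _)) (.colam _ (noSubE_AtebE e)))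
end

/-- For every syntactic object `t` (command, term or context), `Ateb t`
reduces to `t` in zero or more reduction steps, and `Ateb t` contains no
explicit substitutions. -/
theorem Ateb_reduces :
    (∀ c : Cmd, Relation.ReflTransGen RedC (AtebC c) c ∧ NoSubC (AtebC c)) ∧
    (∀ v : Tv, Relation.ReflTransGen RedV (AtebV v) v ∧ NoSubV (AtebV v)) ∧
    (∀ e : Te, Relation.ReflTransGen RedE (AtebE e) e ∧ NoSubE (AtebE e)) :=
  ⟨fun c => ⟨AtebC_reduces c, noSubC_AtebC c⟩, fun v => ⟨AtebV_reduces v, noSubV_AtebV v⟩,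
    fun e => ⟨AtebE_reduces e, noSubE_AtebE e⟩⟩

end LambdaBarMuMuTilde
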